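/- Second Trotter–Kato theorem in the Ito–Kappel framework: Let X and X_n be Banach spaces with bounded operators P_n : X → X_n, E_n : X_n → X satisfying sup_n ‖P_n‖ < ∞, sup_n ‖E_n‖ < ∞, P_n E_n = Id_{X_n}, and let A_n ∈ G(M, 0, X_n) generate C₀-semigroups (T_n(t)). If there exists λ₀ > 0 and a bounded operator R on X with dense range such that ‖E_n R(λ₀, A_n) P_n x − R x‖ → 0 for all x ∈ X, then there exists a C₀-semigroup (T(t))_{t≥0} on X such that ‖E_n T_n(t) P_n x − T(t) x‖ → 0 for all x ∈ X, uniformly for t in bounded intervals. -/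

import Mathlib

open Filter MeasureTheory

section Laplace

variable {X : Type*} [NormedAddCommGroup X] [NormedSpace ℝ X]

theorem integrableOn_exp_neg_smul_of_bounded {f : ℝ → X} {C lam : ℝ}
    (hf : ContinuousOn f (Set.Ici 0)) (hC : ∀ t, 0 ≤ t → ‖f t‖ ≤ C) (hlam : 0 < lam) :
    IntegrableOn (fun t => Real.exp (-lam * t) • f t) (Set.Ioi 0) := by
  have h1 := (exp_neg_integrableOn_Ioi 0 hlam).mul_const C
  refine Integrable.mono' h1 ?_ ?_
  · refine ContinuousOn.aestronglyMeasurable ?_ measurableSet_Ioi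
    exact (by fun_prop : Continuous fun t : ℝ => Real.exp (-lam * t)).continuousOn.smul
      (hf.mono Set.Ioi_subset_Ici_self)
  · filter_upwards [self_mem_ae_restrict measurableSet_Ioi] with t ht
    rw [norm_smul, Real.norm_eq_abs, abs_of_pos (Real.exp_pos _)]
    exact mul_le_mul_of_nonneg_left (hC t (le_of_lt ht)) (Real.exp_pos _).le

theorem integral_exp_neg_mul_Ioi_zero {lam : ℝ} (hlam : 0 < lam) :
    ∫ t in Set.Ioi (0 : ℝ), Real.exp (-lam * t) = 1 / lam := by
  rw [integral_exp_mul_Ioi (by linarith)]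
  simp

theorem norm_integral_exp_neg_smul_le {f : ℝ → X} {C lam : ℝ}
    (hC : ∀ t, 0 ≤ t → ‖f t‖ ≤ C) (hlam : 0 < lam) :
    ‖∫ t in Set.Ioi (0 : ℝ), Real.exp (-lam * t) • f t‖ ≤ C / lam := by
  have h1 := (exp_neg_integrableOn_Ioi 0 hlam).mul_const C
  refine (norm_integral_le_of_norm_le h1 ?_).trans_eq ?_
  · filter_upwards [self_mem_ae_restrict measurableSet_Ioi] with t ht
    rw [norm_smul, Real.norm_eq_abs, abs_of_pos (Real.exp_pos _)]
    exact mul_le_mul_of_nonneg_left (hC t (le_of_lt ht)) (Real.exp_pos _).le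
  · rw [integral_mul_const, integral_exp_neg_mul_Ioi_zero hlam]
    ring

theorem setIntegral_Ioi_comp_add (G : ℝ → X) (t : ℝ) :
    ∫ s in Set.Ioi (0 : ℝ), G (t + s) = ∫ s in Set.Ioi t, G s := by
  have h := (measurePreserving_add_left volume t).setIntegral_preimage_emb
    (measurableEmbedding_addLeft t) G (Set.Ioi t)
  simpa using h

/-- If the Laplace transforms of `f n` converge along the arithmetic progression `lam + k`, then
so do the integrals of `f n` against `exp (-lam * t) * p (exp (-t))` for every polynomial `p`. -/
theorem exists_tendsto_integral_polynomial {f : ℕ → ℝ → X} {C lam : ℝ} (hlam : 0 < lam)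
    (hf : ∀ n, ContinuousOn (f n) (Set.Ici 0)) (hC : ∀ n t, 0 ≤ t → ‖f n t‖ ≤ C)
    (hlim : ∀ k : ℕ, ∃ y, Tendsto
      (fun n => ∫ t in Set.Ioi (0 : ℝ), Real.exp (-(lam + k) * t) • f n t) atTop (nhds y))
    (p : Polynomial ℝ) :
    ∃ y, Tendsto (fun n => ∫ t in Set.Ioi (0 : ℝ),
      Real.exp (-lam * t) • (p.eval (Real.exp (-t)) • f n t)) atTop (nhds y) := by
  have hexp : ∀ (k : ℕ) (t : ℝ),
      Real.exp (-(lam + k) * t) = Real.exp (-lam * t) * Real.exp (-t) ^ k := by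
    intro k t
    rw [← Real.exp_nat_mul, ← Real.exp_add]
    ring_nf
  choose y hy using hlim
  refine ⟨∑ k ∈ p.support, p.coeff k • y k, ?_⟩
  have key : ∀ n, ∫ t in Set.Ioi (0 : ℝ),
      Real.exp (-lam * t) • (p.eval (Real.exp (-t)) • f n t) =
      ∑ k ∈ p.support, p.coeff k •
        ∫ t in Set.Ioi (0 : ℝ), Real.exp (-(lam + k) * t) • f n t := by
    intro n
    simp_rw [← integral_smul]
    rw [← integral_finsetSum]
    · refine integral_congr_ae (Eventually.of_forall fun t => ?_)
      simp only [Polynomial.eval_eq_sum, Polynomial.sum, Finset.sum_smul, Finset.smul_sum]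
      refine Finset.sum_congr rfl fun k _ => ?_
      rw [hexp, smul_smul, smul_smul]
      ring_nf
    · intro k _
      exact (integrableOn_exp_neg_smul_of_bounded (hf n) (hC n) (by positivity)).smul _
  simp_rw [key]
  exact tendsto_finsetSum _ fun k _ => (hy k).const_smul _

theorem cauchySeq_integral_continuous [CompleteSpace X] {f : ℕ → ℝ → X} {C lam : ℝ}
    (hlam : 0 < lam)
    (hf : ∀ n, ContinuousOn (f n) (Set.Ici 0)) (hC : ∀ n t, 0 ≤ t → ‖f n t‖ ≤ C)
    (hlim : ∀ k : ℕ, ∃ y, Tendsto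
      (fun n => ∫ t in Set.Ioi (0 : ℝ), Real.exp (-(lam + k) * t) • f n t) atTop (nhds y))
    {φ : ℝ → ℝ} (hφ : Continuous φ) {B : ℝ} (hB : ∀ u, |φ u| ≤ B) :
    CauchySeq (fun n => ∫ t in Set.Ioi (0 : ℝ),
      Real.exp (-lam * t) • (φ (Real.exp (-t)) • f n t)) := by
  have hC0 : 0 ≤ C := (norm_nonneg _).trans (hC 0 0 le_rfl)
  rw [Metric.cauchySeq_iff]
  intro ε hε
  obtain ⟨p, hp⟩ := exists_polynomial_near_of_continuousOn 0 1 φ hφ.continuousOn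
    (ε * lam / (3 * (C + 1))) (by positivity)
  obtain ⟨y, hy⟩ := exists_tendsto_integral_polynomial hlam hf hC hlim p
  obtain ⟨N, hN⟩ := Metric.cauchySeq_iff.1 hy.cauchySeq (ε / 3) (by positivity)
  have hd : ∀ t : ℝ, 0 ≤ t →
      |p.eval (Real.exp (-t)) - φ (Real.exp (-t))| ≤ ε * lam / (3 * (C + 1)) := fun t ht =>
    (hp _ ⟨(Real.exp_pos _).le, Real.exp_le_one_iff.2 (by linarith)⟩).le
  have hclose : ∀ n, ‖(∫ t in Set.Ioi (0 : ℝ),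
      Real.exp (-lam * t) • (p.eval (Real.exp (-t)) • f n t)) - ∫ t in Set.Ioi (0 : ℝ),
      Real.exp (-lam * t) • (φ (Real.exp (-t)) • f n t)‖ < ε / 3 := by
    intro n
    have hφb : ∀ t, 0 ≤ t → ‖φ (Real.exp (-t)) • f n t‖ ≤ B * C := fun t ht => by
      rw [norm_smul]
      exact mul_le_mul (hB _) (hC n t ht) (norm_nonneg _) ((abs_nonneg _).trans (hB 0))
    have hdb : ∀ t, 0 ≤ t → ‖(p.eval (Real.exp (-t)) - φ (Real.exp (-t))) • f n t‖ ≤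
        ε * lam / (3 * (C + 1)) * C := fun t ht => by
      rw [norm_smul]
      exact mul_le_mul (hd t ht) (hC n t ht) (norm_nonneg _) (by positivity)
    have i1 := integrableOn_exp_neg_smul_of_bounded
      ((by fun_prop : Continuous fun t => φ (Real.exp (-t))).continuousOn.smul (hf n)) hφb hlam
    have i2 := integrableOn_exp_neg_smul_of_bounded
      ((by fun_prop : Continuous fun t : ℝ =>
        p.eval (Real.exp (-t)) - φ (Real.exp (-t))).continuousOn.smul (hf n)) hdb hlam
    have e : ∀ t, Real.exp (-lam * t) • (p.eval (Real.exp (-t)) • f n t) =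
        Real.exp (-lam * t) • ((p.eval (Real.exp (-t)) - φ (Real.exp (-t))) • f n t) +
        Real.exp (-lam * t) • (φ (Real.exp (-t)) • f n t) := fun t => by
      rw [← smul_add, ← add_smul, sub_add_cancel]
    simp_rw [e]
    have hadd := integral_add i2 i1
    simp only [Pi.smul_apply'] at hadd
    rw [hadd, add_sub_cancel_right]
    refine (norm_integral_exp_neg_smul_le hdb hlam).trans_lt ?_
    have : ε * lam / (3 * (C + 1)) * C / lam = ε / 3 * (C / (C + 1)) := by field_simp
    rw [this]
    have h2 : C / (C + 1) < 1 := by rw [div_lt_one (by positivity)]; linarith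
    nlinarith
  refine ⟨N, fun m hm n hn => ?_⟩
  have h1 := hclose m
  have h2 := hclose n
  have h3 := hN m hm n hn
  rw [← dist_eq_norm] at h1 h2
  rw [dist_comm] at h1
  linarith [dist_triangle4 (∫ t in Set.Ioi (0 : ℝ),
      Real.exp (-lam * t) • (φ (Real.exp (-t)) • f m t)) (∫ t in Set.Ioi (0 : ℝ),
      Real.exp (-lam * t) • (p.eval (Real.exp (-t)) • f m t)) (∫ t in Set.Ioi (0 : ℝ),
      Real.exp (-lam * t) • (p.eval (Real.exp (-t)) • f n t)) (∫ t in Set.Ioi (0 : ℝ),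
      Real.exp (-lam * t) • (φ (Real.exp (-t)) • f n t))]

/-- A bounded, equi-Lipschitz sequence of functions on the half-line whose Laplace transforms
converge along an arithmetic progression converges pointwise. -/
theorem exists_tendsto_of_tendsto_laplace [CompleteSpace X] {f : ℕ → ℝ → X} {C L lam : ℝ}
    (hlam : 0 < lam)
    (hf : ∀ n, ContinuousOn (f n) (Set.Ici 0)) (hC : ∀ n t, 0 ≤ t → ‖f n t‖ ≤ C)
    (hL : ∀ n s t, 0 ≤ s → 0 ≤ t → ‖f n t - f n s‖ ≤ L * |t - s|)
    (hlim : ∀ k : ℕ, ∃ y, Tendsto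
      (fun n => ∫ t in Set.Ioi (0 : ℝ), Real.exp (-(lam + k) * t) • f n t) atTop (nhds y))
    {t₀ : ℝ} (ht₀ : 0 ≤ t₀) : ∃ y, Tendsto (fun n => f n t₀) atTop (nhds y) := by
  refine cauchySeq_tendsto_of_complete (Metric.cauchySeq_iff.2 fun ε hε => ?_)
  have hL0 : 0 ≤ L := by
    have := (norm_nonneg _).trans (hL 0 0 1 le_rfl zero_le_one)
    simpa using this
  set η : ℝ := ε / (3 * (L + 1)) with hη
  have hη0 : 0 < η := by positivity
  obtain ⟨δ, hδ, hδη⟩ : ∃ δ > 0, ∀ t : ℝ, |Real.exp (-t) - Real.exp (-t₀)| < δ →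
      |t - t₀| < η := by
    have hc : ContinuousAt Real.log (Real.exp (-t₀)) :=
      Real.continuousAt_log (Real.exp_pos _).ne'
    obtain ⟨δ, hδ, h⟩ := Metric.continuousAt_iff.1 hc η hη0
    refine ⟨δ, hδ, fun t ht => ?_⟩
    have := h (x := Real.exp (-t)) (by rwa [Real.dist_eq])
    rw [Real.dist_eq, Real.log_exp, Real.log_exp, neg_sub_neg, abs_sub_comm] at this
    exact this
  set φ : ℝ → ℝ := fun u => max 0 (δ - |u - Real.exp (-t₀)|) with hφdef
  have hφ : Continuous φ := by fun_prop
  have hφ0 : ∀ u, 0 ≤ φ u := fun u => le_max_left _ _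
  have hφδ : ∀ u, |φ u| ≤ δ := fun u => by
    rw [abs_of_nonneg (hφ0 u)]
    exact max_le hδ.le (by linarith [abs_nonneg (u - Real.exp (-t₀))])
  set w : ℝ → ℝ := fun t => Real.exp (-lam * t) * φ (Real.exp (-t)) with hw
  have hwc : Continuous w := by fun_prop
  have hw0 : ∀ t, 0 ≤ w t := fun t => mul_nonneg (Real.exp_pos _).le (hφ0 _)
  have hwi : IntegrableOn w (Set.Ioi 0) :=
    integrableOn_exp_neg_smul_of_bounded
      (by fun_prop : Continuous fun t => φ (Real.exp (-t))).continuousOn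
      (fun t _ => hφδ _) hlam
  set W : ℝ := ∫ t in Set.Ioi (0 : ℝ), w t with hWdef
  have hW : 0 < W := by
    rw [hWdef, setIntegral_pos_iff_support_of_nonneg_ae (Eventually.of_forall hw0) hwi]
    refine (hwc.isOpen_support.inter isOpen_Ioi).measure_pos _ ?_
    have hmem : Function.support w ∈ nhds t₀ := by
      refine hwc.isOpen_support.mem_nhds ?_
      simp [hw, hφdef, hδ]
    obtain ⟨r, hr, hball⟩ := Metric.mem_nhds_iff.1 hmem
    refine ⟨t₀ + r / 2, hball ?_, ?_⟩
    · rw [Metric.mem_ball, Real.dist_eq, add_sub_cancel_left, abs_of_pos (by positivity)]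
      linarith
    · exact add_pos_of_nonneg_of_pos ht₀ (by positivity)
  set J : ℕ → X := fun n => ∫ t in Set.Ioi (0 : ℝ),
      Real.exp (-lam * t) • (φ (Real.exp (-t)) • f n t) with hJ
  have hclose : ∀ n, ‖W • f n t₀ - J n‖ ≤ W * (ε / 3) := by
    intro n
    have i1 : IntegrableOn (fun t => Real.exp (-lam * t) • (φ (Real.exp (-t)) • f n t))
        (Set.Ioi 0) := by
      refine integrableOn_exp_neg_smul_of_bounded (C := δ * C)
        ((by fun_prop : Continuous fun t => φ (Real.exp (-t))).continuousOn.smul (hf n))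
        (fun t ht => ?_) hlam
      rw [norm_smul]
      exact mul_le_mul (hφδ _) (hC n t ht) (norm_nonneg _) hδ.le
    have e : W • f n t₀ - J n = ∫ t in Set.Ioi (0 : ℝ), w t • (f n t₀ - f n t) := by
      rw [hWdef, ← integral_smul_const, hJ, ← integral_sub (hwi.smul_const _) i1]
      refine integral_congr_ae (Eventually.of_forall fun t => ?_)
      simp only [hw, smul_sub, mul_smul]
    rw [e, hWdef, ← integral_mul_const]
    refine norm_integral_le_of_norm_le (hwi.mul_const _) ?_
    filter_upwards [self_mem_ae_restrict measurableSet_Ioi] with t ht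
    rw [norm_smul, Real.norm_eq_abs, abs_of_nonneg (hw0 t)]
    by_cases hwt : w t = 0
    · simp [hwt]
    refine mul_le_mul_of_nonneg_left ?_ (hw0 t)
    have hlt : |Real.exp (-t) - Real.exp (-t₀)| < δ := by
      by_contra! hcon
      exact hwt (by simp only [hw, hφdef]; rw [max_eq_left (by linarith), mul_zero])
    have h1 := hL n t t₀ (le_of_lt ht) ht₀
    rw [abs_sub_comm] at h1
    have h2 : L * |t - t₀| ≤ L * η := mul_le_mul_of_nonneg_left (hδη t hlt).le hL0
    have h3 : L * η ≤ ε / 3 := by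
      have : (L + 1) * η = ε / 3 := by rw [hη]; field_simp
      nlinarith
    linarith
  obtain ⟨N, hN⟩ := Metric.cauchySeq_iff.1
    (cauchySeq_integral_continuous hlam hf hC hlim hφ hφδ) (W * (ε / 3)) (by positivity)
  refine ⟨N, fun m hm n hn => ?_⟩
  have h1 := hclose m
  have h2 := hclose n
  have h3 := hN m hm n hn
  rw [← dist_eq_norm] at h1 h2
  rw [dist_comm] at h2
  have h4 : dist (W • f m t₀) (W • f n t₀) < W * ε := by
    linarith [dist_triangle4 (W • f m t₀) (J m) (J n) (W • f n t₀)]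
  rw [dist_smul₀, Real.norm_eq_abs, abs_of_pos hW] at h4
  exact lt_of_mul_lt_mul_left h4 hW.le

end Laplace

theorem tendstoUniformlyOn_Icc_of_lipschitz {X : Type*} [NormedAddCommGroup X]
    {f : ℕ → ℝ → X} {g : ℝ → X} {L b : ℝ}
    (hL : ∀ n s t, 0 ≤ s → 0 ≤ t → ‖f n t - f n s‖ ≤ L * |t - s|)
    (hlim : ∀ t, 0 ≤ t → Tendsto (fun n => f n t) atTop (nhds (g t))) :
    TendstoUniformlyOn f g atTop (Set.Icc 0 b) := by
  have hL0 : 0 ≤ L := by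
    have := (norm_nonneg _).trans (hL 0 0 1 le_rfl zero_le_one)
    simpa using this
  have hLg : ∀ s t, 0 ≤ s → 0 ≤ t → ‖g t - g s‖ ≤ L * |t - s| := fun s t hs ht =>
    le_of_tendsto ((hlim t ht).sub (hlim s hs)).norm (Eventually.of_forall fun n => hL n s t hs ht)
  rw [← tendstoLocallyUniformlyOn_iff_tendstoUniformlyOn_of_compact isCompact_Icc,
    Metric.tendstoLocallyUniformlyOn_iff]
  intro ε hε t ht
  set η : ℝ := ε / (3 * (L + 1)) with hη
  have hη0 : 0 < η := by positivity
  refine ⟨Metric.ball t η ∩ Set.Icc 0 b,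
    inter_mem (mem_nhdsWithin_of_mem_nhds (Metric.ball_mem_nhds t hη0)) self_mem_nhdsWithin, ?_⟩
  filter_upwards [Metric.tendsto_nhds.1 (hlim t ht.1) (ε / 3) (by positivity)] with n hn s hs
  have hst : |s - t| < η := hs.1
  have h3 : L * |s - t| ≤ ε / 3 := by
    have : (L + 1) * η = ε / 3 := by rw [hη]; field_simp
    nlinarith
  have h1 := hLg t s ht.1 hs.2.1
  have h2 := hL n t s ht.1 hs.2.1
  rw [← dist_eq_norm] at h1 h2
  rw [dist_comm] at h2 hn
  linarith [dist_triangle4 (g s) (g t) (f n t) (f n s)]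

section Semigroup

variable {X : Type*} [NormedAddCommGroup X] [NormedSpace ℂ X]

/-- A (possibly degenerate) strongly continuous semigroup `S` bounded by `K`, i.e. `S 0` is only
required to be a projection, together with its resolvent `Q`. -/
structure IsBoundedSemigroup (K : ℝ) (S Q : ℝ → X →L[ℂ] X) : Prop where
  map_add : ∀ s t, 0 ≤ s → 0 ≤ t → S (s + t) = S s * S t
  continuousOn : ∀ x, ContinuousOn (fun t => S t x) (Set.Ici 0)
  norm_le : ∀ t, 0 ≤ t → ‖S t‖ ≤ K
  resolvent_apply : ∀ lam : ℝ, 0 < lam → ∀ x,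
    Q lam x = ∫ t in Set.Ioi (0 : ℝ), Real.exp (-lam * t) • S t x

namespace IsBoundedSemigroup

variable {K : ℝ} {S Q : ℝ → X →L[ℂ] X}

theorem nonneg (h : IsBoundedSemigroup K S Q) : 0 ≤ K :=
  (norm_nonneg _).trans (h.norm_le 0 le_rfl)

theorem norm_apply_le (h : IsBoundedSemigroup K S Q) {t : ℝ} (ht : 0 ≤ t) (x : X) :
    ‖S t x‖ ≤ K * ‖x‖ :=
  (S t).le_of_opNorm_le (h.norm_le t ht) x

theorem integrableOn (h : IsBoundedSemigroup K S Q) {lam : ℝ} (hlam : 0 < lam) (x : X) :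
    IntegrableOn (fun t => Real.exp (-lam * t) • S t x) (Set.Ioi 0) :=
  integrableOn_exp_neg_smul_of_bounded (h.continuousOn x) (fun _ ht => h.norm_apply_le ht x) hlam

theorem norm_resolvent_apply_le (h : IsBoundedSemigroup K S Q) {lam : ℝ} (hlam : 0 < lam)
    (x : X) : ‖Q lam x‖ ≤ K / lam * ‖x‖ := by
  rw [h.resolvent_apply lam hlam, div_mul_eq_mul_div]
  exact norm_integral_exp_neg_smul_le (fun t ht => h.norm_apply_le ht x) hlam

theorem norm_resolvent_le (h : IsBoundedSemigroup K S Q) {lam : ℝ} (hlam : 0 < lam) :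
    ‖Q lam‖ ≤ K / lam :=
  (Q lam).opNorm_le_bound (div_nonneg h.nonneg hlam.le) (h.norm_resolvent_apply_le hlam)

variable [CompleteSpace X]

theorem apply_resolvent (h : IsBoundedSemigroup K S Q) {mu : ℝ} (hmu : 0 < mu) (x : X)
    {t : ℝ} (ht : 0 ≤ t) :
    S t (Q mu x) =
      Real.exp (mu * t) • (Q mu x - ∫ s in (0 : ℝ)..t, Real.exp (-mu * s) • S s x) := by
  have hint := h.integrableOn hmu x
  have hsplit := intervalIntegral.integral_interval_add_Ioi hint
    (hint.mono_set (Set.Ioi_subset_Ioi ht))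
  rw [← h.resolvent_apply mu hmu x, add_comm] at hsplit
  rw [← eq_sub_of_add_eq hsplit, ← setIntegral_Ioi_comp_add, ← integral_smul,
    h.resolvent_apply mu hmu x, ← ContinuousLinearMap.integral_comp_comm _ hint]
  refine setIntegral_congr_fun measurableSet_Ioi fun s hs => ?_
  rw [ContinuousLinearMap.map_smul_of_tower, h.map_add t s ht (le_of_lt hs), smul_smul,
    ← Real.exp_add, mul_apply_eq_comp]
  ring_nf

theorem apply_zero_resolvent (h : IsBoundedSemigroup K S Q) {mu : ℝ} (hmu : 0 < mu) (x : X) :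
    S 0 (Q mu x) = Q mu x := by
  simpa using h.apply_resolvent hmu x le_rfl

/-- The orbits of points in the range of the resolvent extend to differentiable curves. -/
theorem exists_hasDerivAt (h : IsBoundedSemigroup K S Q) {mu : ℝ} (hmu : 0 < mu) (x : X) :
    ∃ u : ℝ → X, (∀ t, 0 ≤ t → u t = S t (Q mu x)) ∧
      ∀ t, 0 ≤ t → HasDerivAt u (mu • u t - S t x) t := by
  set g : ℝ → X := fun s => Real.exp (-mu * s) • S (max s 0) x with hg
  have hgc : Continuous g := by
    have h1 : Continuous fun s : ℝ => S (max s 0) x :=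
      (h.continuousOn x).comp_continuous (by fun_prop) fun s => Set.mem_Ici.2 (le_max_right _ _)
    exact (by fun_prop : Continuous fun s : ℝ => Real.exp (-mu * s)).smul h1
  refine ⟨fun t => Real.exp (mu * t) • (Q mu x - ∫ s in (0 : ℝ)..t, g s), fun t ht => ?_,
    fun t ht => ?_⟩
  · rw [h.apply_resolvent hmu x ht]
    simp only
    congr 2
    refine intervalIntegral.integral_congr fun s hs => ?_
    rw [Set.uIcc_of_le ht] at hs
    simp only [hg, max_eq_left hs.1]
  · have hF : HasDerivAt (fun t => ∫ s in (0 : ℝ)..t, g s) (g t) t :=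
      intervalIntegral.integral_hasDerivAt_right (hgc.intervalIntegrable _ _)
        (hgc.stronglyMeasurableAtFilter _ _) hgc.continuousAt
    have hE : HasDerivAt (fun t : ℝ => Real.exp (mu * t)) (Real.exp (mu * t) * mu) t := by
      simpa using ((hasDerivAt_id t).const_mul mu).exp
    convert! hE.smul (hF.const_sub (Q mu x)) using 1
    have h1 : S t x = Real.exp (mu * t) • g t := by
      simp only [hg, max_eq_left ht]
      rw [smul_smul, ← Real.exp_add]
      simp
    rw [h1, smul_neg, smul_smul, mul_comm mu]
    abel

theorem norm_apply_resolvent_sub_le (h : IsBoundedSemigroup K S Q) {mu : ℝ} (hmu : 0 < mu)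
    (x : X) {s t : ℝ} (hs : 0 ≤ s) (ht : 0 ≤ t) :
    ‖S t (Q mu x) - S s (Q mu x)‖ ≤ (K * K + K) * ‖x‖ * |t - s| := by
  obtain ⟨u, hu, hderiv⟩ := h.exists_hasDerivAt hmu x
  rw [← hu t ht, ← hu s hs]
  refine (convex_Ici (0 : ℝ)).norm_image_sub_le_of_norm_hasDerivWithin_le
    (fun r hr => (hderiv r hr).hasDerivWithinAt) (fun r hr => ?_) hs ht
  rw [hu r hr]
  refine (norm_sub_le _ _).trans ?_
  have h1 := h.norm_apply_le hr (Q mu x)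
  have h2 := h.norm_apply_le hr x
  have h3 := h.norm_resolvent_apply_le hmu x
  have h4 : mu * ‖S r (Q mu x)‖ ≤ K * K * ‖x‖ := by
    calc mu * ‖S r (Q mu x)‖ ≤ mu * (K * (K / mu * ‖x‖)) := by
          have := h.nonneg
          gcongr
          exact h1.trans (by gcongr)
      _ = K * K * ‖x‖ := by field_simp
  rw [norm_smul, Real.norm_eq_abs, abs_of_pos hmu]
  linarith

theorem resolvent_identity (h : IsBoundedSemigroup K S Q) {lam mu : ℝ} (hlam : 0 < lam)
    (hmu : 0 < mu) (x : X) :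
    Q lam x - Q mu x = (mu - lam) • Q lam (Q mu x) := by
  obtain ⟨u, hu, hderiv⟩ := h.exists_hasDerivAt hmu x
  have i1 := h.integrableOn hlam (Q mu x)
  have i2 := h.integrableOn hlam x
  have hexp : ∀ t : ℝ, HasDerivAt (fun t : ℝ => Real.exp (-lam * t))
      (Real.exp (-lam * t) * -lam) t := fun t => by
    simpa using ((hasDerivAt_id t).const_mul (-lam)).exp
  have hd : ∀ t ∈ Set.Ici (0 : ℝ), HasDerivAt (fun t => Real.exp (-lam * t) • u t)
      ((mu - lam) • (Real.exp (-lam * t) • S t (Q mu x)) - Real.exp (-lam * t) • S t x) t := by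
    intro t ht
    convert! (hexp t).smul (hderiv t ht) using 1
    rw [← hu t ht]
    module
  have hlim : Tendsto (fun t => Real.exp (-lam * t) • u t) atTop (nhds 0) := by
    have h0 : Tendsto (fun t : ℝ => Real.exp (-lam * t) * (K * ‖Q mu x‖)) atTop (nhds 0) := by
      have h1 : Tendsto (fun t : ℝ => Real.exp (-lam * t)) atTop (nhds 0) := by
        refine Real.tendsto_exp_atBot.comp ?_
        exact tendsto_id.const_mul_atTop_of_neg (by linarith)
      simpa using h1.mul_const (K * ‖Q mu x‖)
    refine squeeze_zero_norm' ?_ h0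
    filter_upwards [eventually_ge_atTop 0] with t ht
    rw [norm_smul, Real.norm_eq_abs, abs_of_pos (Real.exp_pos _), hu t ht]
    exact mul_le_mul_of_nonneg_left (h.norm_apply_le ht _) (Real.exp_pos _).le
  have hint := integral_Ioi_of_hasDerivAt_of_tendsto' hd ((i1.smul (mu - lam)).sub i2) hlim
  have hadd := integral_sub (i1.smul (mu - lam)) i2
  simp only [Pi.smul_apply] at hadd
  rw [hadd, integral_smul, ← h.resolvent_apply lam hlam, ← h.resolvent_apply lam hlam,
    hu 0 le_rfl, h.apply_zero_resolvent hmu] at hint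
  simp only [mul_zero, Real.exp_zero, one_smul, zero_sub] at hint
  have : (mu - lam) • Q lam (Q mu x) = Q lam x - Q mu x := by
    rw [sub_eq_iff_eq_add] at hint
    rw [hint]; abel
  exact this.symm

end IsBoundedSemigroup

end Semigroup

section Convergence

variable {X : Type*} [NormedAddCommGroup X] [NormedSpace ℂ X]

theorem tendsto_apply_of_tendsto_strong {A : ℕ → X →L[ℂ] X} {C : ℝ} (hA : ∀ n, ‖A n‖ ≤ C)
    {x : ℕ → X} {x₀ y : X} (hAx : Tendsto (fun n => A n x₀) atTop (nhds y))
    (hx : Tendsto x atTop (nhds x₀)) : Tendsto (fun n => A n (x n)) atTop (nhds y) := by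
  have h0 : Tendsto (fun n => C * ‖x n - x₀‖) atTop (nhds 0) := by
    simpa using (tendsto_iff_norm_sub_tendsto_zero.1 hx).const_mul C
  have h1 : Tendsto (fun n => A n (x n - x₀)) atTop (nhds 0) :=
    squeeze_zero_norm (fun n => (A n).le_of_opNorm_le (hA n) _) h0
  simpa using h1.add hAx

variable [CompleteSpace X] {K : ℝ} {S Q : ℕ → ℝ → X →L[ℂ] X}

theorem exists_tendsto_resolvent_of_near (h : ∀ n, IsBoundedSemigroup K (S n) (Q n))
    {lam mu : ℝ} (hlam : 0 < lam) (hmu : 0 < mu) (hnear : |mu - lam| * (K / mu) < 1)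
    {R : X →L[ℂ] X} (hR : ∀ x, Tendsto (fun n => Q n mu x) atTop (nhds (R x))) :
    ∃ R' : X →L[ℂ] X, ∀ x, Tendsto (fun n => Q n lam x) atTop (nhds (R' x)) := by
  have hRle : ‖R‖ ≤ K / mu :=
    R.opNorm_le_bound (div_nonneg (h 0).nonneg hmu.le) fun x =>
      le_of_tendsto (hR x).norm
        (Eventually.of_forall fun n => (h n).norm_resolvent_apply_le hmu x)
  have hB : ‖(mu - lam) • R‖ < 1 := by
    rw [norm_smul, Real.norm_eq_abs]
    exact (mul_le_mul_of_nonneg_left hRle (abs_nonneg _)).trans_lt hnear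
  set U := Units.oneSub ((mu - lam) • R) hB with hU
  refine ⟨(↑U⁻¹ : X →L[ℂ] X) * R, fun x => ?_⟩
  set y : X := ((↑U⁻¹ : X →L[ℂ] X) * R) x with hy
  have hyR : y - (mu - lam) • R y = R x := by
    have h1 : (U : X →L[ℂ] X) * ((↑U⁻¹ : X →L[ℂ] X) * R) = R := Units.mul_inv_cancel_left U R
    have h2 := congrArg (fun A : X →L[ℂ] X => A x) h1
    simpa [hU, hy, Units.val_oneSub] using h2
  set e : ℕ → X := fun n => Q n mu x - y + (mu - lam) • Q n mu y with he
  have he0 : Tendsto e atTop (nhds 0) := by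
    have h1 := ((hR x).sub_const y).add ((hR y).const_smul (mu - lam))
    have h2 : R x - y + (mu - lam) • R y = 0 := by rw [← hyR]; abel
    rwa [h2] at h1
  rw [tendsto_iff_norm_sub_tendsto_zero]
  have hlim : Tendsto (fun n => ‖e n‖ / (1 - |mu - lam| * (K / mu))) atTop (nhds 0) := by
    simpa using he0.norm.div_const (1 - |mu - lam| * (K / mu))
  refine squeeze_zero (fun n => norm_nonneg _) (fun n => ?_) hlim
  rw [le_div_iff₀ (by linarith)]
  have hres := (h n).resolvent_identity hmu hlam x
  have hdec : Q n lam x - y = e n + (mu - lam) • Q n mu (Q n lam x - y) := by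
    have h1 : Q n lam x = Q n mu x + (mu - lam) • Q n mu (Q n lam x) := by
      rw [sub_eq_iff_eq_add.1 hres]; module
    simp only [he, map_sub, smul_sub]
    nth_rw 1 [h1]
    abel
  have hle : ‖(mu - lam) • Q n mu (Q n lam x - y)‖ ≤
      |mu - lam| * (K / mu) * ‖Q n lam x - y‖ := by
    rw [norm_smul, Real.norm_eq_abs, mul_assoc]
    exact mul_le_mul_of_nonneg_left ((h n).norm_resolvent_apply_le hmu _) (abs_nonneg _)
  have htri := norm_add_le (e n) ((mu - lam) • Q n mu (Q n lam x - y))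
  rw [← hdec] at htri
  linarith

theorem exists_tendsto_resolvent_of_le (h : ∀ n, IsBoundedSemigroup K (S n) (Q n))
    {lam₀ : ℝ} (hlam₀ : 0 < lam₀)
    {R : X →L[ℂ] X} (hR : ∀ x, Tendsto (fun n => Q n lam₀ x) atTop (nhds (R x)))
    {lam : ℝ} (hle : lam₀ ≤ lam) :
    ∃ R' : X →L[ℂ] X, ∀ x, Tendsto (fun n => Q n lam x) atTop (nhds (R' x)) := by
  have hK := (h 0).nonneg
  set c : ℝ := 1 + 1 / (2 * (K + 1)) with hc
  have hc1 : 1 < c := by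
    have : 0 < 1 / (2 * (K + 1)) := by positivity
    linarith
  have key : ∀ j : ℕ, ∀ lam, lam₀ ≤ lam → lam ≤ lam₀ * c ^ j →
      ∃ R' : X →L[ℂ] X, ∀ x, Tendsto (fun n => Q n lam x) atTop (nhds (R' x)) := by
    intro j
    induction j with
    | zero =>
      intro lam h1 h2
      obtain rfl : lam = lam₀ := le_antisymm (by simpa using h2) h1
      exact ⟨R, hR⟩
    | succ j ih =>
      intro lam h1 h2
      by_cases h3 : lam ≤ lam₀ * c ^ j
      · exact ih lam h1 h3
      push Not at h3
      set mu := lam₀ * c ^ j with hmu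
      have hmu0 : lam₀ ≤ mu := le_mul_of_one_le_right hlam₀.le (one_le_pow₀ hc1.le)
      have hmupos : 0 < mu := hlam₀.trans_le hmu0
      obtain ⟨R₁, hR₁⟩ := ih mu hmu0 le_rfl
      refine exists_tendsto_resolvent_of_near h (hlam₀.trans_le h1) hmupos ?_ hR₁
      rw [abs_sub_comm, abs_of_pos (by linarith)]
      have h4 : lam - mu ≤ mu * (1 / (2 * (K + 1))) := by
        have : lam ≤ mu * c := by rw [hmu, mul_assoc, ← pow_succ]; exact h2
        rw [hc] at this
        linarith
      calc (lam - mu) * (K / mu) ≤ mu * (1 / (2 * (K + 1))) * (K / mu) := by gcongr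
        _ = K / (2 * (K + 1)) := by field_simp
        _ < 1 := by rw [div_lt_one (by positivity)]; linarith
  obtain ⟨j, hj⟩ := pow_unbounded_of_one_lt (lam / lam₀) hc1
  refine key j lam hle ?_
  rw [div_lt_iff₀ hlam₀] at hj
  linarith

theorem exists_tendsto_apply_resolvent (h : ∀ n, IsBoundedSemigroup K (S n) (Q n))
    {lam₀ : ℝ} (hlam₀ : 0 < lam₀)
    {R : X →L[ℂ] X} (hR : ∀ x, Tendsto (fun n => Q n lam₀ x) atTop (nhds (R x)))
    (x : X) {t : ℝ} (ht : 0 ≤ t) :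
    ∃ y, Tendsto (fun n => S n t (Q n lam₀ x)) atTop (nhds y) := by
  have hK := (h 0).nonneg
  refine exists_tendsto_of_tendsto_laplace (f := fun n t => S n t (Q n lam₀ x))
    (C := K * (K / lam₀ * ‖x‖)) hlam₀ (fun n => (h n).continuousOn _) (fun n t ht => ?_)
    (fun n s t hs ht => (h n).norm_apply_resolvent_sub_le hlam₀ x hs ht) (fun k => ?_) ht
  · exact ((h n).norm_apply_le ht _).trans
      (mul_le_mul_of_nonneg_left ((h n).norm_resolvent_apply_le hlam₀ x) hK)
  · have hpos : 0 < lam₀ + k := by positivity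
    obtain ⟨R', hR'⟩ := exists_tendsto_resolvent_of_le h hlam₀ hR (lam := lam₀ + k) (by simp)
    refine ⟨R' (R x), ?_⟩
    simp_rw [← (h _).resolvent_apply (lam₀ + k) hpos]
    exact tendsto_apply_of_tendsto_strong (fun n => (h n).norm_resolvent_le hpos) (hR' _) (hR x)

theorem uniformCauchySeqOn_apply (h : ∀ n, IsBoundedSemigroup K (S n) (Q n))
    {lam₀ : ℝ} (hlam₀ : 0 < lam₀) {R : X →L[ℂ] X} (hdense : DenseRange R)
    (hR : ∀ x, Tendsto (fun n => Q n lam₀ x) atTop (nhds (R x))) (x : X) (b : ℝ) :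
    UniformCauchySeqOn (fun n t => S n t x) atTop (Set.Icc 0 b) := by
  have hK := (h 0).nonneg
  rw [Metric.uniformCauchySeqOn_iff]
  intro ε hε
  set η : ℝ := ε / (3 * (K + 1)) with hη
  have hη0 : 0 < η := by positivity
  have hKη : K * η ≤ ε / 3 := by
    have : (K + 1) * η = ε / 3 := by rw [hη]; field_simp
    nlinarith
  obtain ⟨y, hy⟩ := hdense.exists_dist_lt x hη0
  have hg : ∀ t, ∃ z, 0 ≤ t → Tendsto (fun n => S n t (Q n lam₀ y)) atTop (nhds z) := by
    intro t
    by_cases ht : 0 ≤ t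
    · exact (exists_tendsto_apply_resolvent h hlam₀ hR y ht).imp fun z hz _ => hz
    · exact ⟨0, fun h => absurd h ht⟩
  choose g hg using hg
  have hunif : TendstoUniformlyOn (fun n t => S n t (Q n lam₀ y)) g atTop (Set.Icc 0 b) :=
    tendstoUniformlyOn_Icc_of_lipschitz
      (fun n s t hs ht => (h n).norm_apply_resolvent_sub_le hlam₀ y hs ht) hg
  obtain ⟨N₁, hN₁⟩ :=
    Metric.uniformCauchySeqOn_iff.1 hunif.uniformCauchySeqOn (ε / 3) (by positivity)
  have hev : ∀ᶠ n in atTop, dist x (Q n lam₀ y) < η :=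
    (tendsto_const_nhds.dist (hR y)).eventually_lt_const hy
  obtain ⟨N₂, hN₂⟩ := eventually_atTop.1 hev
  have hclose : ∀ n ≥ N₂, ∀ t, 0 ≤ t → dist (S n t x) (S n t (Q n lam₀ y)) ≤ ε / 3 := by
    intro n hn t ht
    rw [dist_eq_norm, ← map_sub]
    refine ((h n).norm_apply_le ht _).trans (le_trans ?_ hKη)
    rw [← dist_eq_norm]
    exact mul_le_mul_of_nonneg_left (hN₂ n hn).le hK
  refine ⟨max N₁ N₂, fun m hm n hn t ht => ?_⟩
  have h1 := hclose m (le_of_max_le_right hm) t ht.1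
  have h2 := hclose n (le_of_max_le_right hn) t ht.1
  have h3 := hN₁ m (le_of_max_le_left hm) n (le_of_max_le_left hn) t ht
  rw [dist_comm] at h2
  linarith [dist_triangle4 (S m t x) (S m t (Q m lam₀ y)) (S n t (Q n lam₀ y)) (S n t x)]

/-- Strong convergence of the resolvents at one point to an operator with dense range implies
convergence of the semigroups to a strongly continuous semigroup. -/
theorem exists_semigroup_of_tendsto_resolvent (h : ∀ n, IsBoundedSemigroup K (S n) (Q n))
    {lam₀ : ℝ} (hlam₀ : 0 < lam₀) {R : X →L[ℂ] X} (hdense : DenseRange R)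
    (hR : ∀ x, Tendsto (fun n => Q n lam₀ x) atTop (nhds (R x))) :
    ∃ T : ℝ → (X →L[ℂ] X), T 0 = 1 ∧
      (∀ s t : ℝ, 0 ≤ s → 0 ≤ t → T (s + t) = T s * T t) ∧
      (∀ x : X, ContinuousOn (fun t => T t x) (Set.Ici 0)) ∧
      (∀ x : X, ∀ b : ℝ,
        TendstoUniformlyOn (fun n t => S n t x) (fun t => T t x) atTop (Set.Icc 0 b)) := by
  have hcauchy := uniformCauchySeqOn_apply h hlam₀ hdense hR
  have hT : ∀ t, ∃ A : X →L[ℂ] X, 0 ≤ t → ∀ x, Tendsto (fun n => S n t x) atTop (nhds (A x)) := by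
    intro t
    by_cases ht : 0 ≤ t
    · have hy : ∀ x, ∃ y, Tendsto (fun n => S n t x) atTop (nhds y) := fun x =>
        cauchySeq_tendsto_of_complete ((hcauchy x t).cauchySeq ⟨ht, le_rfl⟩)
      choose y hy using hy
      exact ⟨continuousLinearMapOfTendsto (fun n => S n t) (tendsto_pi_nhds.2 hy), fun _ => hy⟩
    · exact ⟨0, fun h => absurd h ht⟩
  choose T hT using hT
  have hunif : ∀ x b, TendstoUniformlyOn (fun n t => S n t x) (fun t => T t x) atTop
      (Set.Icc 0 b) := fun x b =>
    (hcauchy x b).tendstoUniformlyOn_of_tendsto fun t ht => hT t ht.1 x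
  refine ⟨T, ?_, fun s t hs ht => ?_, fun x t ht => ?_, hunif⟩
  · have heq : ⇑(T 0) = id := by
      refine DenseRange.equalizer hdense (T 0).continuous continuous_id (funext fun y => ?_)
      have h1 := tendsto_apply_of_tendsto_strong (fun n => (h n).norm_le 0 le_rfl)
        (hT 0 le_rfl (R y)) (hR y)
      simp_rw [(h _).apply_zero_resolvent hlam₀] at h1
      exact tendsto_nhds_unique h1 (hR y)
    ext x
    exact congrFun heq x
  · ext x
    have h1 := tendsto_apply_of_tendsto_strong (fun n => (h n).norm_le s hs)
      (hT s hs (T t x)) (hT t ht x)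
    refine tendsto_nhds_unique (hT (s + t) (add_nonneg hs ht) x) (h1.congr fun n => ?_)
    rw [(h n).map_add s t hs ht]
    rfl
  · have hc : ContinuousOn (fun t => T t x) (Set.Icc 0 (t + 1)) :=
      (hunif x (t + 1)).continuousOn
        (Frequently.of_forall fun n => ((h n).continuousOn x).mono Set.Icc_subset_Ici_self)
    refine (hc t ⟨ht, by linarith⟩).mono_of_mem_nhdsWithin ?_
    rw [← Set.Ici_inter_Iic]
    exact inter_mem self_mem_nhdsWithin
      (mem_nhdsWithin_of_mem_nhds (Iic_mem_nhds (by linarith)))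

end Convergence

/-- Second Trotter–Kato theorem, Ito–Kappel framework: Let `T_n` be
C₀-semigroups on `X_n` with `‖T_n(t)‖ ≤ M`, with resolvents `R(λ, A_n)` of their
generators given by the Laplace transform. Let `P_n : X → X_n`, `E_n : X_n → X` be
uniformly bounded with `P_n E_n = Id`. If there is `λ₀ > 0` and a bounded operator `R`
on `X` with dense range such that `E_n R(λ₀, A_n) P_n x → R x` for all `x`, then there
is a C₀-semigroup `(T(t))` on `X` with `E_n T_n(t) P_n x → T(t) x` for all `x`,
uniformly for `t` in bounded intervals. -/
theorem second_trotter_kato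
    {X : Type*} [NormedAddCommGroup X] [NormedSpace ℂ X] [CompleteSpace X]
    {Xn : ℕ → Type*} [∀ n, NormedAddCommGroup (Xn n)] [∀ n, NormedSpace ℂ (Xn n)]
    [∀ n, CompleteSpace (Xn n)]
    (M : ℝ) (hM : 1 ≤ M)
    (Tn : ∀ n, ℝ → (Xn n →L[ℂ] Xn n))
    (hT0 : ∀ n, Tn n 0 = 1)
    (hTsg : ∀ n, ∀ s t : ℝ, 0 ≤ s → 0 ≤ t → Tn n (s + t) = Tn n s * Tn n t)
    (hTcont : ∀ n, ∀ x : Xn n, ContinuousOn (fun t => Tn n t x) (Set.Ici 0))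
    (hTbd : ∀ n, ∀ t : ℝ, 0 ≤ t → ‖Tn n t‖ ≤ M)
    (Rn : ∀ n, ℝ → (Xn n →L[ℂ] Xn n))
    (hLaplace : ∀ n, ∀ lam : ℝ, 0 < lam → ∀ x : Xn n,
      Rn n lam x = ∫ t in Set.Ioi (0 : ℝ), Real.exp (-lam * t) • Tn n t x)
    (E : ∀ n, Xn n →L[ℂ] X) (P : ∀ n, X →L[ℂ] Xn n)
    (ME MP : ℝ) (hE : ∀ n, ‖E n‖ ≤ ME) (hP : ∀ n, ‖P n‖ ≤ MP)
    (hPE : ∀ n, (P n).comp (E n) = ContinuousLinearMap.id ℂ (Xn n))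
    (lam₀ : ℝ) (hlam₀ : 0 < lam₀)
    (R : X →L[ℂ] X) (hdense : Dense (Set.range R))
    (hconv : ∀ x : X,
      Tendsto (fun n => E n (Rn n lam₀ (P n x))) atTop (nhds (R x))) :
    ∃ T : ℝ → (X →L[ℂ] X),
      T 0 = 1 ∧
      (∀ s t : ℝ, 0 ≤ s → 0 ≤ t → T (s + t) = T s * T t) ∧
      (∀ x : X, ContinuousOn (fun t => T t x) (Set.Ici 0)) ∧
      (∀ x : X, ∀ b : ℝ, 0 < b →
        TendstoUniformlyOn (fun (n : ℕ) (t : ℝ) => E n (Tn n t (P n x)))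
          (fun t => T t x) atTop (Set.Icc 0 b)) := by
  have hM0 : 0 ≤ M := zero_le_one.trans hM
  have hME : 0 ≤ ME := (norm_nonneg _).trans (hE 0)
  have h : ∀ n, IsBoundedSemigroup (ME * M * MP)
      (fun t => (E n).comp ((Tn n t).comp (P n)))
      (fun lam => (E n).comp ((Rn n lam).comp (P n))) := by
    intro n
    refine ⟨fun s t hs ht => ?_, fun x => ?_, fun t ht => ?_, fun lam hlam x => ?_⟩
    · ext x
      have hPEx : ∀ z, P n (E n z) = z := fun z =>
        congrArg (fun A : Xn n →L[ℂ] Xn n => A z) (hPE n)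
      simp [hTsg n s t hs ht, hPEx]
    · exact (E n).continuous.comp_continuousOn (hTcont n (P n x))
    · refine ((E n).opNorm_comp_le _).trans ?_
      rw [mul_assoc]
      refine mul_le_mul (hE n) (((Tn n t).opNorm_comp_le _).trans ?_) (norm_nonneg _) hME
      exact mul_le_mul (hTbd n t ht) (hP n) (norm_nonneg _) hM0
    · simp only [ContinuousLinearMap.comp_apply]
      rw [hLaplace n lam hlam, ← ContinuousLinearMap.integral_comp_comm]
      · simp_rw [ContinuousLinearMap.map_smul_of_tower]
      · exact integrableOn_exp_neg_smul_of_bounded (hTcont n (P n x))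
          (fun t ht => (Tn n t).le_of_opNorm_le (hTbd n t ht) _) hlam
  obtain ⟨T, h0, hadd, hcont, hunif⟩ :=
    exists_semigroup_of_tendsto_resolvent h hlam₀ hdense hconv
  exact ⟨T, h0, hadd, hcont, fun x b _ => hunif x b⟩
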